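/- Combining the chain of bounds: if q(x|y) ≥ ε ν(x), d(x,y) ∈ [b,1], and t_∞ is the stationary distribution of the implicit MH kernel, then ‖t_∞ − p‖²_TV ≤ ((4 + 2b)/(3 ε² b³)) · ( E_{x∼p, y∼q(·|x)}[log(d(y,x)/d(x,y)) + d(y,x)/d(x,y)] − 1 + KL(q(y|x)p(x) ‖ q(x|y)p(y)) ). -/

import Mathlib

open MeasureTheory

theorem two_mul_sub_one_le_add_one_mul_log {u : ℝ} (hu : 1 ≤ u) :
    2 * (u - 1) ≤ (u + 1) * Real.log u := by
  have h := Real.le_log_one_add_of_nonneg (x := u - 1) (by linarith)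
  rw [div_le_iff₀ (by linarith)] at h
  rw [show 1 + (u - 1) = u by ring] at h
  nlinarith

theorem add_one_mul_log_le_two_mul_sub_one {u : ℝ} (hu : 0 < u) (hu1 : u ≤ 1) :
    (u + 1) * Real.log u ≤ 2 * (u - 1) := by
  have h := two_mul_sub_one_le_add_one_mul_log (u := u⁻¹) ((one_le_inv₀ hu).2 hu1)
  rw [Real.log_inv] at h
  have h2 := mul_le_mul_of_nonneg_left h hu.le
  have e1 : u * (2 * (u⁻¹ - 1)) = 2 * (1 - u) := by field_simp
  have e2 : u * ((u⁻¹ + 1) * -Real.log u) = -((u + 1) * Real.log u) := by field_simp; ring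
  linarith

/-- Pointwise form of Pinsker's inequality. -/
theorem three_mul_sub_one_sq_le {u : ℝ} (hu : 0 < u) :
    3 * (u - 1) ^ 2 ≤ (4 + 2 * u) * (u * Real.log u - u + 1) := by
  let ψ : ℝ → ℝ := fun u => (4 + 2 * u) * (u * Real.log u - u + 1) - 3 * (u - 1) ^ 2
  have hd : ∀ v : ℝ, 0 < v → HasDerivAt ψ (4 * ((v + 1) * Real.log v - 2 * (v - 1))) v := by
    intro v hv
    have h1 := ((hasDerivAt_id v).const_mul 2).const_add 4
    have h2 := (((hasDerivAt_id v).mul (Real.hasDerivAt_log hv.ne')).sub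
      (hasDerivAt_id v)).add_const 1
    have h3 := (((hasDerivAt_id v).sub_const 1).pow 2).const_mul 3
    refine ((h1.mul h2).sub h3).congr_deriv ?_
    simp
    field_simp
    ring
  have h1 : ψ 1 = 0 := by simp [ψ]
  suffices 0 ≤ ψ u by simp only [ψ] at this; linarith
  rw [← h1]
  rcases le_total 1 u with h | h
  · have : MonotoneOn ψ (Set.Ici 1) := by
      refine monotoneOn_of_deriv_nonneg (convex_Ici 1)
        (fun v hv => (hd v (by linarith [Set.mem_Ici.1 hv])).continuousAt.continuousWithinAt)
        (fun v hv => ?_) (fun v hv => ?_)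
      · rw [interior_Ici] at hv
        exact (hd v (by linarith [Set.mem_Ioi.1 hv])).differentiableAt.differentiableWithinAt
      · rw [interior_Ici] at hv
        have hv' := Set.mem_Ioi.1 hv
        rw [(hd v (by linarith)).deriv]
        linarith [two_mul_sub_one_le_add_one_mul_log hv'.le]
    exact this (Set.mem_Ici.2 le_rfl) h h
  · have : AntitoneOn ψ (Set.Ioc 0 1) := by
      refine antitoneOn_of_deriv_nonpos (convex_Ioc 0 1)
        (fun v hv => (hd v hv.1).continuousAt.continuousWithinAt)
        (fun v hv => ?_) (fun v hv => ?_)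
      · rw [interior_Ioc] at hv
        exact (hd v hv.1).differentiableAt.differentiableWithinAt
      · rw [interior_Ioc] at hv
        rw [(hd v hv.1).deriv]
        linarith [add_one_mul_log_le_two_mul_sub_one hv.1 hv.2.le]
    exact this ⟨hu, h⟩ ⟨one_pos, le_rfl⟩ h

/-- Two-variable form of the pointwise Pinsker inequality. -/
theorem sub_sq_le_mul_log_div {a c : ℝ} (ha : 0 < a) (hc : 0 < c) :
    (a - c) ^ 2 ≤ (4 * c + 2 * a) / 3 * (a * Real.log (a / c) - a + c) := by
  have h := mul_le_mul_of_nonneg_left (three_mul_sub_one_sq_le (div_pos ha hc)) (sq_nonneg c)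
  have e1 : c ^ 2 * (3 * (a / c - 1) ^ 2) = 3 * (a - c) ^ 2 := by field_simp
  have e2 : c ^ 2 * ((4 + 2 * (a / c)) * (a / c * Real.log (a / c) - a / c + 1)) =
      (4 * c + 2 * a) * (a * Real.log (a / c) - a + c) := by field_simp
  rw [e1, e2] at h
  linarith

theorem le_of_sq_le_mul {u A B t : ℝ} (ht : 0 < t) (hA : 0 ≤ A) (hB : 0 ≤ B)
    (h : u ^ 2 ≤ A * B) : u ≤ t / 2 * A + B / (2 * t) := by
  have h0 : 0 ≤ t / 2 * A + B / (2 * t) := by positivity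
  refine (le_abs_self u).trans (abs_le_of_sq_le_sq ?_ h0)
  have e : (t / 2 * A + B / (2 * t)) ^ 2 - A * B = (t / 2 * A - B / (2 * t)) ^ 2 := by
    field_simp; ring
  nlinarith [sq_nonneg (t / 2 * A - B / (2 * t))]

/-- The antisymmetrization of this function is the part of the pointwise bound whose integral
vanishes.  On the diagonal `a = a'` it is expressed through `a * (log r + r)` and its swap only,
because `a` and `r` need not be jointly measurable there. -/
noncomputable def balance (b t a a' r X : ℝ) : ℝ :=
  if a = a' then
    -((a * (Real.log r + r) + a' * (Real.log r⁻¹ + r⁻¹)) / 2 * X) - a * (Real.log r + r) / (4 * t)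
  else a * min 1 r * (1 - X) - 2 * t / (3 * b) * a - a * r / (2 * t)

/-- The pointwise upper bound for the defect of detailed balance. -/
noncomputable def defectBound (b t a a' r X Y : ℝ) : ℝ :=
  (t / 2 * ((4 + 2 * b) / (3 * b)) - 1 / (2 * t)) * a +
    1 / (2 * t) * (a * (Real.log r + r) + a * Real.log (a / a')) +
      (balance b t a a' r X - balance b t a' a r⁻¹ Y)

theorem le_defectBound_of_ne {b t a a' r X Y e : ℝ} (hb : 0 < b) (ht : 0 < t) (ha : 0 < a)
    (ha' : 0 < a') (hr : b ≤ r) (hne : a ≠ a')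
    (he : e ^ 2 ≤ (a - a' / r) ^ 2) :
    a * min 1 r * (1 - X) - a' * min 1 r⁻¹ * (1 - Y) + e ≤ defectBound b t a a' r X Y := by
  have hr0 : 0 < r := hb.trans_le hr
  have hc : 0 < a' / r := div_pos ha' hr0
  have hk := sub_sq_le_mul_log_div ha hc
  have hk0 : 0 ≤ a * Real.log (a / (a' / r)) - a + a' / r := by
    by_contra hneg
    push Not at hneg
    nlinarith [sq_nonneg (a - a' / r)]
  have h1 := le_of_sq_le_mul ht (by positivity) hk0 (he.trans hk)
  have hcb : a' / r ≤ a' / b := div_le_div_of_nonneg_left ha'.le hb hr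
  have h2 : t / 2 * ((4 * (a' / r) + 2 * a) / 3) ≤ t / 2 * ((4 * (a' / b) + 2 * a) / 3) := by
    gcongr
  have hlog : Real.log (a / (a' / r)) = Real.log r + Real.log (a / a') := by
    rw [show a / (a' / r) = r * (a / a') by field_simp]
    exact Real.log_mul hr0.ne' (div_pos ha ha').ne'
  rw [hlog] at h1
  have key : defectBound b t a a' r X Y = a * min 1 r * (1 - X) - a' * min 1 r⁻¹ * (1 - Y) +
      (t / 2 * ((4 * (a' / b) + 2 * a) / 3) +
        (a * (Real.log r + Real.log (a / a')) - a + a' / r) / (2 * t)) := by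
    unfold defectBound balance
    rw [if_neg hne, if_neg hne.symm]
    field_simp
    ring
  rw [key]
  linarith

theorem le_defectBound_diag {b t a r X Y : ℝ} (hb : 0 < b) (ht : 0 < t) (ha : 0 < a)
    (hr : b ≤ r) (hr' : b ≤ r⁻¹) (hX : X ≤ 1) (hY : 0 ≤ Y) :
    a * min 1 r * (1 - X) - a * min 1 r⁻¹ * (1 - Y) ≤ defectBound b t a a r X Y ∧
      (X = 0 → a * min 1 r⁻¹ * Y ≤ defectBound b t a a r X Y) := by
  have hr0 : 0 < r := hb.trans_le hr
  have hi0 : 0 < r⁻¹ := inv_pos.2 hr0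
  have hri : r * r⁻¹ = 1 := mul_inv_cancel₀ hr0.ne'
  obtain ⟨S, hS⟩ : ∃ S, S = a * ((r + r⁻¹) / 2) := ⟨_, rfl⟩
  have hm : 0 < min 1 r⁻¹ := lt_min one_pos hi0
  have hm1 : min 1 r⁻¹ ≤ 1 := min_le_left _ _
  have hm2 : min 1 r ≤ 1 := min_le_left _ _
  have hch : 1 ≤ (r + r⁻¹) / 2 := by nlinarith [sq_nonneg (r - r⁻¹)]
  have hSa : a ≤ S := by rw [hS]; nlinarith
  have hb1 : b ≤ 1 := by
    by_contra h
    push Not at h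
    nlinarith
  have hV : (r + r⁻¹) / 2 + 1 ≤ (4 + 2 * b) / (3 * b) := by
    have h1 : r + r⁻¹ ≤ b + b⁻¹ := by
      have : 0 ≤ (r - b) * (r⁻¹ - b) := mul_nonneg (by linarith) (by linarith)
      have h2 : b * (r + r⁻¹) ≤ b * (b + b⁻¹) := by
        rw [mul_add b b, mul_inv_cancel₀ hb.ne']; nlinarith
      exact le_of_mul_le_mul_left h2 hb
    have h3 : (b + b⁻¹) / 2 + 1 ≤ (4 + 2 * b) / (3 * b) := by
      rw [le_div_iff₀ (by positivity)]
      field_simp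
      nlinarith
    linarith
  have hdef : defectBound b t a a r X Y = S * (Y - X) +
      (t / 2 * ((4 + 2 * b) / (3 * b) * a) + (S - a) / (2 * t)) := by
    unfold defectBound balance
    rw [if_pos rfl, if_pos rfl, div_self ha.ne', Real.log_one, inv_inv, Real.log_inv, hS]
    field_simp
    ring
  have hsq : (S - a * min 1 r⁻¹) ^ 2 ≤ (4 + 2 * b) / (3 * b) * a * (S - a) := by
    have h1 : ((r + r⁻¹) / 2 - min 1 r⁻¹) ^ 2 ≤ ((r + r⁻¹) / 2 + 1) * ((r + r⁻¹) / 2 - 1) := by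
      rcases le_total 1 r⁻¹ with h | h
      · rw [min_eq_left h]; nlinarith
      · rw [min_eq_right h]; nlinarith
    have h2 : ((r + r⁻¹) / 2 + 1) * ((r + r⁻¹) / 2 - 1) ≤
        (4 + 2 * b) / (3 * b) * ((r + r⁻¹) / 2 - 1) :=
      mul_le_mul_of_nonneg_right hV (by linarith)
    have h3 := mul_le_mul_of_nonneg_left (h1.trans h2) (sq_nonneg a)
    rw [hS]
    calc _ = a ^ 2 * ((r + r⁻¹) / 2 - min 1 r⁻¹) ^ 2 := by ring
      _ ≤ _ := h3
      _ = _ := by ring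
  have h1 := le_of_sq_le_mul ht (by positivity) (by linarith) hsq
  have h0 : 0 ≤ t / 2 * ((4 + 2 * b) / (3 * b) * a) + (S - a) / (2 * t) := by
    have : 0 ≤ S - a := by linarith
    positivity
  have hP' : a * min 1 r⁻¹ ≤ S := by nlinarith
  have hP : a * min 1 r ≤ S := by nlinarith
  rw [hdef]
  refine ⟨?_, ?_⟩
  · nlinarith [mul_nonneg (sub_nonneg.2 hP) (sub_nonneg.2 hX), mul_nonneg (sub_nonneg.2 hP') hY]
  · rintro rfl
    nlinarith [mul_nonneg (sub_nonneg.2 hP') hY]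

theorem min_one_mul_sub_sq_le {a a' r : ℝ} (hr : 0 < r) :
    (a' * min 1 r⁻¹ - a * min 1 r) ^ 2 ≤ (a - a' / r) ^ 2 := by
  rcases le_total 1 r with h | h
  · rw [min_eq_left h, min_eq_right (inv_le_one_of_one_le₀ h)]
    apply le_of_eq; field_simp; ring
  · rw [min_eq_right h, min_eq_left ((one_le_inv₀ hr).2 h)]
    have : (a' * 1 - a * r) ^ 2 = r ^ 2 * (a - a' / r) ^ 2 := by field_simp; ring
    rw [this]
    exact mul_le_of_le_one_left (sq_nonneg _) (by nlinarith)

theorem le_defectBound {b t a a' r X Y : ℝ} (hb : 0 < b) (ht : 0 < t) (ha : 0 < a)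
    (ha' : 0 < a') (hr : b ≤ r) (hr' : b ≤ r⁻¹) (hX : X ≤ 1) (hY : 0 ≤ Y) :
    a * min 1 r * (1 - X) - a' * min 1 r⁻¹ * (1 - Y) ≤ defectBound b t a a' r X Y ∧
      (X = 0 → a' * min 1 r⁻¹ * Y ≤ defectBound b t a a' r X Y) := by
  by_cases hne : a = a'
  · subst hne
    exact le_defectBound_diag hb ht ha hr hr' hX hY
  · refine ⟨?_, ?_⟩
    · simpa using le_defectBound_of_ne (X := X) (Y := Y) (e := 0) hb ht ha ha' hr hne
        (by simpa using sq_nonneg (a - a' / r))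
    · rintro rfl
      have := le_defectBound_of_ne (X := 0) (Y := Y) hb ht ha ha' hr hne
        (min_one_mul_sub_sq_le (hb.trans_le hr))
      linarith

theorem measurableEmbedding_add_exp :
    MeasurableEmbedding (fun u : ℝ => u + Real.exp u) := by
  refine Continuous.measurableEmbedding (by fun_prop) ?_
  exact (strictMono_id.add Real.exp_strictMono).injective

theorem aemeasurable_of_log_add_self {Ω : Type*} [MeasurableSpace Ω] {μ : Measure Ω} {r : Ω → ℝ}
    (hr : ∀ ω, 0 < r ω) (h : AEMeasurable (fun ω => Real.log (r ω) + r ω) μ) :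
    AEMeasurable r μ := by
  have h1 : AEMeasurable (fun ω => Real.log (r ω)) μ := by
    refine (measurableEmbedding_add_exp.aemeasurable_comp_iff).1 ?_
    convert h using 2 with ω
    simp [Real.exp_log (hr ω)]
  refine (Real.measurable_exp.comp_aemeasurable h1).congr (ae_of_all _ fun ω => ?_)
  simp [Real.exp_log (hr ω)]

theorem aemeasurable_offDiag {Ω : Type*} [MeasurableSpace Ω] {μ : Measure Ω} {a a' r : Ω → ℝ}
    (ha : ∀ ω, 0 < a ω) (ha' : ∀ ω, 0 < a' ω) (hr : ∀ ω, 0 < r ω)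
    (hf : AEMeasurable (fun ω => a ω * Real.log (a ω / a' ω)) μ)
    (hf' : AEMeasurable (fun ω => a' ω * Real.log (a' ω / a ω)) μ)
    (hF : AEMeasurable (fun ω => a ω * (Real.log (r ω) + r ω)) μ) :
    NullMeasurableSet {ω | a ω = a' ω} μ ∧
      AEMeasurable (fun ω => if a ω = a' ω then 0 else a ω) μ ∧
      AEMeasurable (fun ω => if a ω = a' ω then 1 else r ω) μ := by
  have hiff : ∀ ω, a ω * Real.log (a ω / a' ω) = 0 ↔ a ω = a' ω := by
    intro ω
    have := ha ω
    have := ha' ω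
    rw [mul_eq_zero, or_iff_right (ha ω).ne', Real.log_eq_zero, or_iff_right (by positivity),
      or_iff_left (by intro h; have : 0 < a ω / a' ω := by positivity
                      linarith), div_eq_one_iff_eq (ha' ω).ne']
  have hset : NullMeasurableSet {ω | a ω = a' ω} μ := by
    have := hf.nullMeasurable (measurableSet_singleton (0 : ℝ))
    convert this using 1
    ext ω
    simp only [Set.mem_ofPred_eq, Set.mem_preimage, Set.mem_singleton_iff, hiff]
  have hlog : ∀ ω, a ω ≠ a' ω → Real.log (a ω / a' ω) =
      Real.log (-(a ω * Real.log (a ω / a' ω) / (a' ω * Real.log (a' ω / a ω)))) := by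
    intro ω hne
    have h1 : Real.log (a ω / a' ω) ≠ 0 := fun h => hne ((hiff ω).1 (by rw [h, mul_zero]))
    congr 1
    rw [← inv_div (a ω) (a' ω), Real.log_inv]
    have := (ha' ω).ne'
    field_simp
  have hg : AEMeasurable (fun ω => Real.log
      (-(a ω * Real.log (a ω / a' ω) / (a' ω * Real.log (a' ω / a ω))))) μ :=
    Real.measurable_log.comp_aemeasurable (hf.div hf').neg
  have ha0 : AEMeasurable (fun ω => if a ω = a' ω then 0 else a ω) μ := by
    refine (hf.div hg).congr (ae_of_all _ fun ω => ?_)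
    by_cases h : a ω = a' ω
    · simp only [Pi.div_apply, if_pos h, (hiff ω).2 h, zero_div]
    · have h1 : Real.log (a ω / a' ω) ≠ 0 := fun h' => h ((hiff ω).1 (by rw [h', mul_zero]))
      simp only [Pi.div_apply, if_neg h]
      rw [← hlog ω h]
      field_simp
  refine ⟨hset, ha0, aemeasurable_of_log_add_self (fun ω => ?_) ?_⟩
  · split_ifs
    · exact one_pos
    · exact hr ω
  · have h1 := ((hF.div ha0).indicator₀ hset.compl).add
      ((aemeasurable_const (b := (1 : ℝ))).indicator₀ hset)
    refine h1.congr (ae_of_all _ fun ω => ?_)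
    by_cases h : a ω = a' ω
    · simp [Set.indicator, h]
    · have := (ha ω).ne'
      simp [Set.indicator, h]
      field_simp

theorem aemeasurable_section {Ω : Type*} [MeasurableSpace Ω] {μ : Measure Ω} {a a' r : Ω → ℝ}
    (ha : ∀ ω, 0 < a ω) (ha' : ∀ ω, 0 < a' ω) (hr : ∀ ω, 0 < r ω) (ham : AEMeasurable a μ)
    (hf : AEMeasurable (fun ω => a ω * Real.log (a ω / a' ω)) μ)
    (hF : AEMeasurable (fun ω => a ω * (Real.log (r ω) + r ω)) μ) :
    AEMeasurable a' μ ∧ AEMeasurable r μ := by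
  constructor
  · have h1 := ham.mul (Real.measurable_exp.comp_aemeasurable (hf.div ham).neg)
    refine h1.congr (ae_of_all _ fun ω => ?_)
    have := ha ω
    have := ha' ω
    simp only [Pi.mul_apply, Function.comp_apply, Pi.neg_apply, Pi.div_apply]
    rw [mul_div_cancel_left₀ _ (ha ω).ne', Real.exp_neg, Real.exp_log (by positivity)]
    field_simp
  · refine aemeasurable_of_log_add_self hr ((hF.div ham).congr (ae_of_all _ fun ω => ?_))
    simp only [Pi.div_apply]
    rw [mul_div_cancel_left₀ _ (ha ω).ne']

theorem integrable_prod_of_le_kernel {E : Type*} [MeasurableSpace E] {μ : Measure E} [SFinite μ]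
    {g : E × E → ℝ} {c : E → ℝ} {κ : E → E → ℝ} (hg : AEMeasurable g (μ.prod μ))
    (hc : Integrable c μ) (hκ : ∀ y, ∫ x, κ x y ∂μ = 1)
    (hle : ∀ x y, |g (x, y)| ≤ c x * κ y x) : Integrable g (μ.prod μ) := by
  have hκi : ∀ x, Integrable (fun y => c x * κ y x) μ := fun x =>
    (Integrable.of_integral_ne_zero (by rw [hκ]; exact one_ne_zero)).const_mul _
  have hgs := hg.aestronglyMeasurable
  have hsec : ∀ᵐ x ∂μ, Integrable (fun y => g (x, y)) μ := by
    filter_upwards [hgs.prodMk_left] with x hx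
    exact (hκi x).mono' hx (ae_of_all _ fun y => hle x y)
  refine (integrable_prod_iff hgs).2 ⟨hsec, ?_⟩
  refine hc.mono' hgs.norm.integral_prod_right' ?_
  filter_upwards [hsec] with x hx
  rw [Real.norm_of_nonneg (integral_nonneg fun y => norm_nonneg _)]
  calc ∫ y, ‖g (x, y)‖ ∂μ ≤ ∫ y, c x * κ y x ∂μ := integral_mono hx.norm (hκi x) (hle x)
    _ = c x := by rw [integral_const_mul, hκ, mul_one]

theorem integrable_mul_of_abs_le {Ω : Type*} [MeasurableSpace Ω] {μ : Measure Ω} {g h : Ω → ℝ}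
    {C : ℝ} (hg : Integrable g μ) (hh : AEMeasurable h μ) (hC : ∀ ω, |h ω| ≤ C) :
    Integrable (fun ω => g ω * h ω) μ :=
  hg.mul_bdd (c := C) hh.aestronglyMeasurable (ae_of_all _ hC)

section Product

variable {E : Type*} [MeasurableSpace E] {μ : Measure E} [SFinite μ]
  {p φ w : E → ℝ} {κ : E → E → ℝ} {a r : E × E → ℝ} {b t : ℝ}

theorem swap_mul_log_aemeasurable
    (hf : AEMeasurable (fun z => a z * Real.log (a z / a z.swap)) (μ.prod μ)) :
    AEMeasurable (fun z => a z.swap * Real.log (a z.swap / a z)) (μ.prod μ) := by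
  simpa [Function.comp_def] using
    hf.comp_quasiMeasurePreserving (Measure.measurePreserving_swap.quasiMeasurePreserving)

theorem integrable_balance (hb : 0 < b) (hp : Integrable p μ)
    (hκ : ∀ y, ∫ x, κ x y ∂μ = 1)
    (ha : ∀ z, 0 < a z) (haκ : ∀ x y, a (x, y) = p x * κ y x)
    (hr : ∀ z, b ≤ r z) (hr' : ∀ z, b ≤ (r z)⁻¹) (hswap : ∀ z, r z.swap = (r z)⁻¹)
    (hφm : AEMeasurable φ μ) (hφ0 : ∀ x, 0 ≤ φ x) (hφ1 : ∀ x, φ x ≤ 1)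
    (hf : AEMeasurable (fun z => a z * Real.log (a z / a z.swap)) (μ.prod μ))
    (hF : Integrable (fun z => a z * (Real.log (r z) + r z)) (μ.prod μ)) :
    Integrable (fun z => balance b t (a z) (a z.swap) (r z) (φ z.1)) (μ.prod μ) := by
  have hr0 : ∀ z, 0 < r z := fun z => hb.trans_le (hr z)
  obtain ⟨hset, ha0, hr1⟩ := aemeasurable_offDiag ha (fun z => ha z.swap) hr0 hf
    (swap_mul_log_aemeasurable hf) hF.aemeasurable
  have hφz : AEMeasurable (fun z : E × E => φ z.1) (μ.prod μ) :=
    hφm.comp_quasiMeasurePreserving Measure.quasiMeasurePreserving_fst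
  have hF' := hF.swap
  have ia0 : Integrable (fun z => if a z = a z.swap then 0 else a z) (μ.prod μ) := by
    refine integrable_prod_of_le_kernel ha0 hp hκ fun x y => ?_
    rw [← haκ]
    split_ifs
    · simpa using (ha _).le
    · exact (abs_of_pos (ha _)).le
  have i1 := (integrable_mul_of_abs_le ((hF.add hF').div_const 2) hφz (C := 1)
    (fun z => abs_le.2 ⟨by linarith [hφ0 z.1], hφ1 z.1⟩)).neg.sub (hF.div_const (4 * t))
  have i2 := integrable_mul_of_abs_le ia0 (C := 1)
    (((aemeasurable_const (b := (1 : ℝ))).min hr1).mul (hφz.const_sub 1)) (fun z => by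
      have h1 : 0 < if a z = a z.swap then 1 else r z := by
        split_ifs
        exacts [one_pos, hr0 z]
      have h2 : 0 < min 1 (if a z = a z.swap then 1 else r z) := lt_min one_pos h1
      have h3 : min 1 (if a z = a z.swap then 1 else r z) ≤ 1 := min_le_left _ _
      have h4 := hφ0 z.1
      have h5 := hφ1 z.1
      simp only [Pi.mul_apply]
      rw [abs_of_nonneg (mul_nonneg h2.le (by linarith))]
      nlinarith)
  have i3 := integrable_mul_of_abs_le ia0 (C := 1 + b⁻¹) hr1 (fun z => by
      have h1 : r z ≤ b⁻¹ := (le_inv_comm₀ hb (hr0 z)).1 (hr' z)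
      have h2 := hr0 z
      split_ifs
      · rw [abs_one]
        have := inv_pos.2 hb
        linarith
      · rw [abs_of_pos h2]
        linarith)
  refine ((i1.indicator₀ hset).add ((i2.sub (ia0.const_mul (2 * t / (3 * b)))).sub
    (i3.div_const (2 * t)))).congr (ae_of_all _ fun z => ?_)
  by_cases h : a z = a z.swap
  · simp [Set.indicator, balance, h, hswap]
  · simp [Set.indicator, balance, h]
    ring

theorem integrable_section_of_flow (hb : 0 < b) (hp : ∀ x, 0 < p x)
    (hpm : Integrable p μ) (hw : Integrable w μ) (hw0 : ∀ x, 0 ≤ w x)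
    (hκ : ∀ y, ∫ x, κ x y ∂μ = 1)
    (ha : ∀ z, 0 < a z) (haκ : ∀ x y, a (x, y) = p x * κ y x)
    (hr : ∀ z, b ≤ r z) (hr' : ∀ z, b ≤ (r z)⁻¹) (hswap : ∀ z, r z.swap = (r z)⁻¹)
    (hf : AEMeasurable (fun z => a z * Real.log (a z / a z.swap)) (μ.prod μ))
    (hF : Integrable (fun z => a z * (Real.log (r z) + r z)) (μ.prod μ)) :
    ∀ᵐ x ∂μ, ∃ g : E → ℝ, Integrable g μ ∧ ∀ y, κ x y * w y ≤ g y := by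
  have hr0 : ∀ z, 0 < r z := fun z => hb.trans_le (hr z)
  obtain ⟨hset, ha0, -⟩ := aemeasurable_offDiag ha (fun z => ha z.swap) hr0 hf
    (swap_mul_log_aemeasurable hf) hF.aemeasurable
  set F : E × E → ℝ := fun z => a z * (Real.log (r z) + r z) with hFdef
  have hum : AEMeasurable (fun z => if a z = a z.swap then (F z + F z.swap) / 2 else a z)
      (μ.prod μ) := by
    refine ((((hF.add hF.swap).div_const 2).aemeasurable.indicator₀ hset).add ha0).congr
      (ae_of_all _ fun z => ?_)
    by_cases h : a z = a z.swap <;> simp [Set.indicator, h]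
  have hub : ∀ z, a z ≤ (if a z = a z.swap then (F z + F z.swap) / 2 else a z) ∧
      (if a z = a z.swap then (F z + F z.swap) / 2 else a z) ≤ b⁻¹ * a z := by
    intro z
    have h1 : r z ≤ b⁻¹ := (le_inv_comm₀ hb (hr0 z)).1 (hr' z)
    have h2 : (r z)⁻¹ ≤ b⁻¹ := inv_anti₀ hb (hr z)
    have h3 : r z * (r z)⁻¹ = 1 := mul_inv_cancel₀ (hr0 z).ne'
    have h4 : 0 < (r z)⁻¹ := inv_pos.2 (hr0 z)
    have h5 : 2 ≤ r z + (r z)⁻¹ := by nlinarith [sq_nonneg (r z - (r z)⁻¹), hr0 z]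
    have h6 := ha z
    split_ifs with h
    · have e : (F z + F z.swap) / 2 = a z * ((r z + (r z)⁻¹) / 2) := by
        simp only [hFdef, ← h, hswap, Real.log_inv]
        ring
      rw [e]
      constructor <;> nlinarith
    · exact ⟨le_rfl, by nlinarith⟩
  have hpz : AEMeasurable (fun z : E × E => w z.1 / p z.1) (μ.prod μ) :=
    (hw.aemeasurable.div hpm.aemeasurable).comp_quasiMeasurePreserving
      Measure.quasiMeasurePreserving_fst
  have hint := integrable_prod_of_le_kernel (hum.mul hpz) (hw.const_mul b⁻¹) hκ
    (fun x y => by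
      have h1 := hub (x, y)
      have h2 : 0 ≤ w x / p x := div_nonneg (hw0 x) (hp x).le
      have h3 := ha (x, y)
      simp only [Pi.mul_apply]
      rw [abs_of_nonneg (mul_nonneg (h3.le.trans h1.1) h2)]
      refine (mul_le_mul_of_nonneg_right h1.2 h2).trans (le_of_eq ?_)
      rw [haκ]
      have := (hp x).ne'
      field_simp)
  filter_upwards [hint.swap.prod_right_ae] with x hx
  refine ⟨_, hx, fun y => ?_⟩
  have h2 : 0 ≤ w y / p y := div_nonneg (hw0 y) (hp y).le
  refine le_trans (le_of_eq ?_) (mul_le_mul_of_nonneg_right (hub (y, x)).1 h2)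
  change κ x y * w y = a (y, x) * (w y / p y)
  rw [haκ]
  have := (hp y).ne'
  field_simp

end Product

theorem sq_le_mul_of_forall_le {s V K : ℝ} (hs : 0 ≤ s) (hV : 0 < V)
    (h : ∀ t, 0 < t → s ≤ t / 2 * V + K / (2 * t)) : s ^ 2 ≤ V * K := by
  rcases hs.eq_or_lt with rfl | hs
  · suffices 0 ≤ K by simpa using mul_nonneg hV.le this
    by_contra! hK
    have ht : 0 < Real.sqrt (-K / (2 * V)) := Real.sqrt_pos.2 (by
      apply div_pos <;> linarith)
    have hsq := Real.sq_sqrt (show 0 ≤ -K / (2 * V) by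
      apply div_nonneg <;> linarith)
    have h1 := h _ ht
    set t := Real.sqrt (-K / (2 * V))
    have h2 := mul_le_mul_of_nonneg_left h1 (mul_pos two_pos ht).le
    have e : 2 * t * (t / 2 * V + K / (2 * t)) = t ^ 2 * V + K := by field_simp
    rw [e, hsq] at h2
    have e2 : -K / (2 * V) * V = -K / 2 := by field_simp
    linarith
  · have h1 := h (s / V) (by positivity)
    have e : s / V / 2 * V + K / (2 * (s / V)) = s / 2 + V * K / (2 * s) := by field_simp
    rw [e] at h1
    have h2 : s / 2 ≤ V * K / (2 * s) := by linarith
    rw [le_div_iff₀ (by positivity)] at h2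
    nlinarith

theorem integral_max_zero_eq {Ω : Type*} [MeasurableSpace Ω] {μ : Measure Ω} {g h : Ω → ℝ}
    (hg : Integrable g μ) (hh : Integrable h μ) (heq : ∫ x, g x ∂μ = ∫ x, h x ∂μ) :
    Integrable (fun x => max 0 (g x - h x)) μ ∧
      ∫ x, max 0 (g x - h x) ∂μ = 1 / 2 * ∫ x, |g x - h x| ∂μ := by
  have hi := hg.sub hh
  have e : (fun x => max 0 (g x - h x)) = fun x => 1 / 2 * (|g x - h x| + (g x - h x)) := by
    ext x
    rcases le_total 0 (g x - h x) with h' | h'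
    · rw [max_eq_right h', abs_of_nonneg h']; ring
    · rw [max_eq_left h', abs_of_nonpos h']; ring
  have hs : Integrable (fun x => |g x - h x| + (g x - h x)) μ := hi.abs.add hi
  rw [e]
  refine ⟨hs.const_mul _, ?_⟩
  have e3 : ∫ x, (|g x - h x| + (g x - h x)) ∂μ = ∫ x, |g x - h x| ∂μ + ∫ x, (g x - h x) ∂μ :=
    integral_add hi.abs hi
  rw [integral_const_mul, e3, integral_sub hg hh, heq, sub_self, add_zero]

/-- Main upper bound of the paper: if the proposal satisfies the minorization
condition `q x y ≥ ε ν x`, the discriminator takes values in `[b,1]`, and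
`t∞` is the stationary density of the implicit Metropolis–Hastings kernel,
then the squared TV distance between `t∞` and the target `p` is bounded by
`((4+2b)/(3 ε² b³)) (L(d) − 1 + KL(q(y|x)p(x) ‖ q(x|y)p(y)))`. -/
theorem imh_main_upper_bound {D : ℕ}
    (q : (Fin D → ℝ) → (Fin D → ℝ) → ℝ) (p : (Fin D → ℝ) → ℝ)
    (d : (Fin D → ℝ) → (Fin D → ℝ) → ℝ)
    (ν tinf : (Fin D → ℝ) → ℝ) (ε b : ℝ)
    (hε : 0 < ε) (hb : 0 < b)
    (hq_pos : ∀ x y, 0 < q x y) (hq_kernel : ∀ y, ∫ x, q x y = 1)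
    (hν_nonneg : ∀ x, 0 ≤ ν x) (hν_norm : ∫ x, ν x = 1)
    (hminor : ∀ x y, q x y ≥ ε * ν x)
    (hp_pos : ∀ x, 0 < p x) (hp_int : Integrable p) (hp_norm : ∫ x, p x = 1)
    (hd_lb : ∀ x y, b ≤ d x y) (hd_ub : ∀ x y, d x y ≤ 1)
    (htinf_nonneg : ∀ x, 0 ≤ tinf x) (htinf_int : Integrable tinf)
    (htinf_norm : ∫ x, tinf x = 1)
    -- stationarity of `tinf` under the implicit Metropolis–Hastings kernel
    (hstat : ∀ x, tinf x =
      (∫ y, q x y * min 1 (d x y / d y x) * tinf y) + tinf x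
        - tinf x * ∫ y, q y x * min 1 (d y x / d x y))
    (hL_int : Integrable (fun z : ((Fin D → ℝ) × (Fin D → ℝ)) =>
      p z.1 * q z.2 z.1 * (Real.log (d z.2 z.1 / d z.1 z.2) + d z.2 z.1 / d z.1 z.2)))
    (hKL_int : Integrable (fun z : ((Fin D → ℝ) × (Fin D → ℝ)) =>
      p z.1 * q z.2 z.1 * Real.log (q z.2 z.1 * p z.1 / (q z.1 z.2 * p z.2)))) :
    ((1 / 2) * ∫ x, |tinf x - p x|) ^ 2 ≤
      ((4 + 2 * b) / (3 * ε ^ 2 * b ^ 3)) *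
        ((∫ x, ∫ y, p x * q y x *
            (Real.log (d y x / d x y) + d y x / d x y)) - 1 +
          ∫ x, ∫ y, p x * q y x * Real.log (q y x * p x / (q x y * p y))) := by
  obtain ⟨a, ha_def⟩ : ∃ a : (Fin D → ℝ) × (Fin D → ℝ) → ℝ,
      a = fun z => p z.1 * q z.2 z.1 := ⟨_, rfl⟩
  obtain ⟨r, hr_def⟩ : ∃ r : (Fin D → ℝ) × (Fin D → ℝ) → ℝ,
      r = fun z => d z.2 z.1 / d z.1 z.2 := ⟨_, rfl⟩
  have hd0 : ∀ x y, 0 < d x y := fun x y => hb.trans_le (hd_lb x y)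
  have ha : ∀ z, 0 < a z := fun z => by rw [ha_def]; exact mul_pos (hp_pos _) (hq_pos _ _)
  have haq : ∀ x y, a (x, y) = p x * q y x := fun x y => by rw [ha_def]
  have hswap : ∀ z, r z.swap = (r z)⁻¹ := fun z => by
    rw [hr_def]; exact (inv_div _ _).symm
  have hratio : ∀ x y, b ≤ d x y / d y x := fun x y => by
    rw [le_div_iff₀ (hd0 _ _)]
    exact (mul_le_of_le_one_right hb.le (hd_ub y x)).trans (hd_lb x y)
  have hr : ∀ z, b ≤ r z := fun z => by rw [hr_def]; exact hratio _ _
  have hr' : ∀ z, b ≤ (r z)⁻¹ := fun z => by rw [← hswap]; exact hr _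
  have hr0 : ∀ z, 0 < r z := fun z => hb.trans_le (hr z)
  have hb1 : b ≤ 1 := (hd_lb 0 0).trans (hd_ub 0 0)
  have hF : Integrable (fun z => a z * (Real.log (r z) + r z)) := by
    rw [ha_def, hr_def]; exact hL_int
  have hf : Integrable (fun z => a z * Real.log (a z / a z.swap)) := by
    convert hKL_int using 2 with z
    simp only [ha_def, Prod.fst_swap, Prod.snd_swap, mul_comm (p _)]
  have hν_int : Integrable ν :=
    Integrable.of_integral_ne_zero (by rw [hν_norm]; exact one_ne_zero)
  have hq_int : ∀ y, Integrable (fun x => q x y) := fun y =>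
    Integrable.of_integral_ne_zero (by rw [hq_kernel]; exact one_ne_zero)
  obtain ⟨φ, hφ_def⟩ : ∃ φ : (Fin D → ℝ) → ℝ, φ = fun x => max 0 (1 - tinf x / p x) := ⟨_, rfl⟩
  have hφm : AEMeasurable φ := by
    rw [hφ_def]
    exact aemeasurable_const.max ((htinf_int.aemeasurable.div hp_int.aemeasurable).const_sub 1)
  have hφ0 : ∀ x, 0 ≤ φ x := fun x => by rw [hφ_def]; exact le_max_left _ _
  have hφ1 : ∀ x, φ x ≤ 1 := fun x => by
    have := div_nonneg (htinf_nonneg x) (hp_pos x).le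
    rw [hφ_def]
    exact max_le zero_le_one (by linarith)
  have hpφ : ∀ x, p x * φ x = max 0 (p x - tinf x) := fun x => by
    have := (hp_pos x).ne'
    rw [hφ_def]
    simp only
    rw [mul_max_of_nonneg _ _ (hp_pos x).le, mul_zero, mul_sub, mul_one, mul_div_cancel₀ _ this]
  obtain ⟨hi1, hτ1⟩ := integral_max_zero_eq htinf_int hp_int (by rw [htinf_norm, hp_norm])
  obtain ⟨hi2, hτ2⟩ := integral_max_zero_eq hp_int htinf_int (by rw [htinf_norm, hp_norm])
  simp only [abs_sub_comm (p _)] at hτ2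
  obtain ⟨τ, hτ⟩ : ∃ τ, τ = 1 / 2 * ∫ x, |tinf x - p x| := ⟨_, rfl⟩
  rw [← hτ] at hτ1 hτ2 ⊢
  have hτ0 : 0 ≤ τ := by
    rw [hτ]; exact mul_nonneg (by norm_num) (integral_nonneg fun x => abs_nonneg _)
  obtain ⟨K, hK⟩ : ∃ K, K = (∫ x, ∫ y, a (x, y) * (Real.log (r (x, y)) + r (x, y))) - 1 +
      ∫ x, ∫ y, a (x, y) * Real.log (a (x, y) / a (y, x)) := ⟨_, rfl⟩
  suffices hmain : ∀ t, 0 < t →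
      b * ε * τ ≤ t / 2 * ((4 + 2 * b) / (3 * b)) + K / (2 * t) by
    have h1 := sq_le_mul_of_forall_le (by positivity) (by positivity) hmain
    have hKeq : K = ((∫ x, ∫ y, p x * q y x *
            (Real.log (d y x / d x y) + d y x / d x y)) - 1 +
          ∫ x, ∫ y, p x * q y x * Real.log (q y x * p x / (q x y * p y))) := by
      rw [hK, ha_def, hr_def]
      simp only [mul_comm (p _) (q _ _)]
    rw [← hKeq]
    have e1 : (4 + 2 * b) / (3 * ε ^ 2 * b ^ 3) * K =
        ((4 + 2 * b) / (3 * b) * K) / (b * ε) ^ 2 := by field_simp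
    rw [e1, le_div_iff₀ (by positivity)]
    linarith [mul_pow (b * ε) τ 2, mul_comm ((b * ε) ^ 2) (τ ^ 2)]
  intro t ht
  have hB := integrable_balance (t := t) hb hp_int hq_kernel ha haq hr hr' hswap hφm hφ0 hφ1
    hf.aemeasurable hF
  have hT := hB.sub hB.swap
  have hT0 : ∫ x, ∫ y, (balance b t (a (x, y)) (a (y, x)) (r (x, y)) (φ x) -
      balance b t (a (y, x)) (a (x, y)) (r (x, y))⁻¹ (φ y)) = 0 := by
    have h1 := integral_prod _ hT
    have h2 : ∫ z, (balance b t (a z) (a z.swap) (r z) (φ z.1) -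
        balance b t (a z.swap) (a z.swap.swap) (r z.swap) (φ z.swap.1))
          ∂((volume : Measure (Fin D → ℝ)).prod volume) = 0 := by
      refine (integral_sub hB hB.swap).trans (sub_eq_zero.2 ?_)
      exact (integral_prod_swap (fun z => balance b t (a z) (a z.swap) (r z) (φ z.1))).symm
    rw [← h2]
    refine Eq.trans ?_ h1.symm
    refine integral_congr_ae (ae_of_all _ fun x => integral_congr_ae (ae_of_all _ fun y => ?_))
    simp [← hswap]
  have hpt : ∀ᵐ x, ε * b * ν x * τ ≤
      (t / 2 * ((4 + 2 * b) / (3 * b)) - 1 / (2 * t)) * p x +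
      1 / (2 * t) * ((∫ y, a (x, y) * (Real.log (r (x, y)) + r (x, y))) +
        ∫ y, a (x, y) * Real.log (a (x, y) / a (y, x))) +
      ∫ y, (balance b t (a (x, y)) (a (y, x)) (r (x, y)) (φ x) -
        balance b t (a (y, x)) (a (x, y)) (r (x, y))⁻¹ (φ y)) := by
    filter_upwards [hF.prod_right_ae, hf.prod_right_ae, hT.prod_right_ae,
      integrable_section_of_flow hb hp_pos hp_int htinf_int htinf_nonneg hq_kernel ha haq hr hr'
        hswap hf.aemeasurable hF] with x hFx hfx hTx hWx
    have hax : Integrable (fun y => a (x, y)) := by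
      simp only [haq]; exact (hq_int x).const_mul _
    have hfx' : Integrable (fun y => a (x, y) * Real.log (a (x, y) / a (y, x))) := hfx
    have hFf : Integrable (fun y => a (x, y) * (Real.log (r (x, y)) + r (x, y)) +
        a (x, y) * Real.log (a (x, y) / a (y, x))) := hFx.add hfx'
    have hTx' : Integrable (fun y => balance b t (a (x, y)) (a (y, x)) (r (x, y)) (φ x) -
        balance b t (a (y, x)) (a (x, y)) (r (x, y))⁻¹ (φ y)) := by
      refine hTx.congr (ae_of_all _ fun y => ?_)
      simp [← hswap]
    obtain ⟨ha'm, hrm⟩ := aemeasurable_section (fun y => ha (x, y)) (fun y => ha (y, x))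
      (fun y => hr0 (x, y)) hax.aemeasurable hfx.aemeasurable hFx.aemeasurable
    have hH : Integrable
        (fun y => defectBound b t (a (x, y)) (a (y, x)) (r (x, y)) (φ x) (φ y)) :=
      ((hax.const_mul _).add (hFf.const_mul _)).add hTx'
    have hHint : ∫ y, defectBound b t (a (x, y)) (a (y, x)) (r (x, y)) (φ x) (φ y) =
        (t / 2 * ((4 + 2 * b) / (3 * b)) - 1 / (2 * t)) * p x +
        1 / (2 * t) * ((∫ y, a (x, y) * (Real.log (r (x, y)) + r (x, y))) +
          ∫ y, a (x, y) * Real.log (a (x, y) / a (y, x))) +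
        ∫ y, (balance b t (a (x, y)) (a (y, x)) (r (x, y)) (φ x) -
          balance b t (a (y, x)) (a (x, y)) (r (x, y))⁻¹ (φ y)) := by
      have e1 : ∫ y, a (x, y) = p x := by
        simp only [haq]; rw [integral_const_mul, hq_kernel, mul_one]
      rw [← integral_add hFx hfx', ← e1, ← integral_const_mul, ← integral_const_mul,
        ← integral_add (hax.const_mul _) (hFf.const_mul _)]
      exact integral_add ((hax.const_mul _).add (hFf.const_mul _)) hTx'
    rw [← hHint]
    have hlow : ∀ y, ε * b * ν x ≤ q x y * min 1 (d x y / d y x) := fun y => by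
      have h1 : b ≤ min 1 (d x y / d y x) := le_min hb1 (hratio x y)
      have h2 := mul_le_mul (hminor x y) h1 hb.le (hq_pos x y).le
      linarith
    have hrx : ∀ y, (r (x, y))⁻¹ = d x y / d y x := fun y => by
      rw [← hswap, hr_def]; rfl
    have hflow : ∀ y, a (y, x) * min 1 (r (x, y))⁻¹ =
        q x y * min 1 (d x y / d y x) * p y := fun y => by
      rw [hrx, haq]; ring
    have hbound := fun y => le_defectBound (X := φ x) (Y := φ y) hb ht (ha (x, y)) (ha (y, x))
      (hr (x, y)) (hr' (x, y)) (hφ1 x) (hφ0 y)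
    rcases lt_or_ge (tinf x) (p x) with hlt | hge
    · have hin : Integrable (fun y => q x y * min 1 (d x y / d y x) * tinf y) := by
        obtain ⟨g, hg, hgle⟩ := hWx
        refine hg.mono' ?_ (ae_of_all _ fun y => ?_)
        · refine AEMeasurable.aestronglyMeasurable ?_
          refine (((ha'm.mul ((aemeasurable_const (b := (1 : ℝ))).min hrm.inv)).div
            hp_int.aemeasurable).mul htinf_int.aemeasurable).congr (ae_of_all _ fun y => ?_)
          simp only [Pi.mul_apply, Pi.div_apply, Pi.inv_apply]
          rw [hflow, mul_div_cancel_right₀ _ (hp_pos y).ne']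
        · have h1 : 0 ≤ min 1 (d x y / d y x) := hb.le.trans (le_min hb1 (hratio x y))
          have h2 : min 1 (d x y / d y x) ≤ 1 := min_le_left _ _
          have h3 := mul_nonneg (hq_pos x y).le (htinf_nonneg y)
          rw [Real.norm_of_nonneg (mul_nonneg (mul_nonneg (hq_pos x y).le h1) (htinf_nonneg y))]
          refine le_trans ?_ (hgle y)
          nlinarith
      have hout : Integrable (fun y => q y x * min 1 (d y x / d x y)) := by
        refine integrable_mul_of_abs_le (C := 1) (hq_int x) ?_ (fun y => ?_)
        · rw [hr_def] at hrm
          exact aemeasurable_const.min hrm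
        · rw [abs_of_nonneg (hb.le.trans (le_min hb1 (hratio y x)))]
          exact min_le_left _ _
      have hbal : ∫ y, (q x y * min 1 (d x y / d y x) * tinf y -
          tinf x * (q y x * min 1 (d y x / d x y))) = 0 := by
        rw [integral_sub hin (hout.const_mul _), integral_const_mul]
        linarith [hstat x]
      calc ε * b * ν x * τ = ∫ y, ε * b * ν x * max 0 (tinf y - p y) := by
            rw [integral_const_mul, hτ1]
        _ ≤ ∫ y, (defectBound b t (a (x, y)) (a (y, x)) (r (x, y)) (φ x) (φ y) +
            (q x y * min 1 (d x y / d y x) * tinf y -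
              tinf x * (q y x * min 1 (d y x / d x y)))) := by
            refine integral_mono (hi1.const_mul _) (hH.add (hin.sub (hout.const_mul _))) fun y => ?_
            have h1 := (hbound y).1
            have h2 := mul_le_mul_of_nonneg_right (hlow y) (le_max_left 0 (tinf y - p y))
            have h3 : tinf x = p x * (1 - φ x) := by
              rw [mul_sub, hpφ, max_eq_right (by linarith)]; ring
            have h4 : tinf y = max 0 (tinf y - p y) + p y * (1 - φ y) := by
              rw [mul_sub, hpφ]
              rcases le_total (tinf y) (p y) with h | h
              · rw [max_eq_left (by linarith), max_eq_right (by linarith)]; ring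
              · rw [max_eq_right (by linarith), max_eq_left (by linarith)]; ring
            have h5 : a (x, y) * min 1 (r (x, y)) * (1 - φ x) =
                tinf x * (q y x * min 1 (d y x / d x y)) := by
              rw [h3, haq, hr_def]; ring
            have h6 : q x y * min 1 (d x y / d y x) * tinf y =
                q x y * min 1 (d x y / d y x) * max 0 (tinf y - p y) +
                  a (y, x) * min 1 (r (x, y))⁻¹ * (1 - φ y) := by
              rw [hflow]
              nth_rewrite 1 [h4]
              ring
            simp only
            linarith
        _ = _ := by
            refine (integral_add hH (hin.sub (hout.const_mul (tinf x)))).trans ?_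
            exact add_eq_left.2 hbal
    · have hφx : φ x = 0 := by
        have := hpφ x
        rw [max_eq_left (by linarith)] at this
        exact (mul_eq_zero.1 this).resolve_left (hp_pos x).ne'
      calc ε * b * ν x * τ = ∫ y, ε * b * ν x * max 0 (p y - tinf y) := by
            rw [integral_const_mul, hτ2]
        _ ≤ _ := by
            refine integral_mono (hi2.const_mul _) hH fun y => ?_
            have h1 := (hbound y).2 hφx
            have h2 := mul_le_mul_of_nonneg_right (hlow y) (le_max_left 0 (p y - tinf y))
            rw [hflow, mul_assoc, hpφ] at h1
            exact h2.trans h1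
  have iF : Integrable (fun x => ∫ y, a (x, y) * (Real.log (r (x, y)) + r (x, y))) :=
    hF.integral_prod_left
  have i_f : Integrable (fun x => ∫ y, a (x, y) * Real.log (a (x, y) / a (y, x))) :=
    hf.integral_prod_left
  have iT : Integrable (fun x => ∫ y, (balance b t (a (x, y)) (a (y, x)) (r (x, y)) (φ x) -
      balance b t (a (y, x)) (a (x, y)) (r (x, y))⁻¹ (φ y))) := by
    refine hT.integral_prod_left.congr
      (ae_of_all _ fun x => integral_congr_ae (ae_of_all _ fun y => ?_))
    simp [← hswap]
  have iP := hp_int.const_mul (t / 2 * ((4 + 2 * b) / (3 * b)) - 1 / (2 * t))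
  have iFf : Integrable (fun x => (∫ y, a (x, y) * (Real.log (r (x, y)) + r (x, y))) +
      ∫ y, a (x, y) * Real.log (a (x, y) / a (y, x))) := iF.add i_f
  have iG := iFf.const_mul (1 / (2 * t))
  have iPG : Integrable (fun x => (t / 2 * ((4 + 2 * b) / (3 * b)) - 1 / (2 * t)) * p x +
      1 / (2 * t) * ((∫ y, a (x, y) * (Real.log (r (x, y)) + r (x, y))) +
        ∫ y, a (x, y) * Real.log (a (x, y) / a (y, x)))) := iP.add iG
  have hfin := integral_mono_ae ((hν_int.const_mul (ε * b)).mul_const τ) (iPG.add iT) hpt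
  simp only [Pi.add_apply] at hfin
  rw [integral_mul_const, integral_const_mul, hν_norm, integral_add iPG iT, hT0,
    integral_add iP iG, integral_const_mul, integral_const_mul, hp_norm,
    integral_add iF i_f] at hfin
  have e3 : t / 2 * ((4 + 2 * b) / (3 * b)) + K / (2 * t) =
      (t / 2 * ((4 + 2 * b) / (3 * b)) - 1 / (2 * t)) * 1 + 1 / (2 * t) * (K + 1) := by
    field_simp
    ring
  rw [e3, hK]
  linarith
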